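/- For complex a, b, c, d, e with e not a nonpositive integer, the triple hypergeometric function satisfies the analytic continuation formula Φ[a,b,c,d; e; σ, ω, ρ] = (1−ω)^{−b} · Ψ₀₀[a,b,c,d; e; σ, ω/(ω−1), ρ], where Ψ₀₀[a,b,c,d; e; σ, θ, ρ] = Σ_{m,k≥0} ((a)_m (c)_m)/(m! k! (e)_{m+k}) · F(b, e−d+m+k; e+m+k; θ) · σ^m ρ^k, for |σ| < 1, |ω| < 1/2 (so that |ω/(ω−1)| < 1), ρ arbitrary. -/

import Mathlib

open Complex

/-- Pochhammer symbol `(a)_n = a(a+1)⋯(a+n-1)` for complex `a`. -/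
noncomputable def poch (a : ℂ) (n : ℕ) : ℂ := (ascPochhammer ℂ n).eval a

/-- `c` is not a nonpositive integer `0, -1, -2, …`. -/
def notNonposInt (c : ℂ) : Prop := ∀ n : ℕ, c ≠ -(n : ℂ)

/-- Confluent hypergeometric series `Ξ₂(a,b;c;σ,ρ)`. -/
noncomputable def Xi2 (a b c σ ρ : ℂ) : ℂ :=
  ∑' mk : ℕ × ℕ, poch a mk.1 * poch b mk.1 /
    ((mk.1.factorial : ℂ) * (mk.2.factorial : ℂ) * poch c (mk.1 + mk.2)) * σ ^ mk.1 * ρ ^ mk.2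

/-- Series `Ξ₁₀[a,b;a' | c; c'; σ,ρ]`. -/
noncomputable def Xi10 (a b a' c c' σ ρ : ℂ) : ℂ :=
  ∑' mk : ℕ × ℕ, poch a mk.1 * poch b mk.1 * poch a' mk.2 /
    ((mk.1.factorial : ℂ) * (mk.2.factorial : ℂ) * poch c (mk.1 + mk.2) * poch c' mk.2) *
    σ ^ mk.1 * ρ ^ mk.2

/-- Triple hypergeometric series `Φ[a,b,c,d;e;σ,ω,ρ]`. -/
noncomputable def Phi3 (a b c d e σ ω ρ : ℂ) : ℂ :=
  ∑' t : ℕ × ℕ × ℕ, poch a t.1 * poch b t.2.1 * poch c t.1 * poch d t.2.1 /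
    ((t.1.factorial : ℂ) * (t.2.1.factorial : ℂ) * (t.2.2.factorial : ℂ) *
      poch e (t.1 + t.2.1 + t.2.2)) *
    σ ^ t.1 * ω ^ t.2.1 * ρ ^ t.2.2

/-- Gauss hypergeometric series `F(a,b;c;θ)`. -/
noncomputable def GaussF (a b c θ : ℂ) : ℂ :=
  ∑' n : ℕ, poch a n * poch b n / ((n.factorial : ℂ) * poch c n) * θ ^ n

/-- Series `Ξ_{pq}[a,b;a',b' | c; c',d'; σ,ρ]`, `p, q ∈ {0,1}`. -/
noncomputable def XiPQ (p q : ℕ) (a b a' b' c c' d' σ ρ : ℂ) : ℂ :=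
  ∑' mk : ℕ × ℕ, poch a mk.1 * poch b mk.1 * poch a' (p * mk.2) * poch b' (q * (mk.1 + mk.2)) /
    ((mk.1.factorial : ℂ) * (mk.2.factorial : ℂ) * poch c (mk.1 + mk.2) *
      poch c' (p * mk.2) * poch d' (q * (mk.1 + mk.2))) *
    σ ^ mk.1 * ρ ^ mk.2

/-- Series `Ψ_{pq}[a,b,c,d;a',b' | e; c',d'; σ,θ,ρ]`, `p, q ∈ {0,1}`. -/
noncomputable def PsiPQ (p q : ℕ) (a b c d a' b' e c' d' σ θ ρ : ℂ) : ℂ :=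
  ∑' mk : ℕ × ℕ, poch a mk.1 * poch c mk.1 * poch a' (p * mk.2) * poch b' (q * (mk.1 + mk.2)) /
    ((mk.1.factorial : ℂ) * (mk.2.factorial : ℂ) * poch e (mk.1 + mk.2) *
      poch c' (p * mk.2) * poch d' (q * (mk.1 + mk.2))) *
    GaussF b (e - d + (mk.1 : ℂ) + (mk.2 : ℂ)) (e + (mk.1 : ℂ) + (mk.2 : ℂ)) θ *
    σ ^ mk.1 * ρ ^ mk.2

open Filter Topology Finset

theorem poch_zero (a : ℂ) : poch a 0 = 1 := by simp [poch]

theorem poch_succ (a : ℂ) (n : ℕ) : poch a (n + 1) = poch a n * (a + n) :=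
  ascPochhammer_succ_eval n a

theorem poch_add (a : ℂ) (m n : ℕ) : poch a (m + n) = poch a m * poch (a + m) n := by
  induction n with
  | zero => simp [poch_zero]
  | succ n ih => rw [← add_assoc, poch_succ, ih, poch_succ]; push_cast; ring

theorem poch_succ_left (a : ℂ) (n : ℕ) : poch a (n + 1) = a * poch (a + 1) n := by
  rw [add_comm, poch_add, poch_succ, poch_zero]; simp

theorem poch_ne_zero {c : ℂ} (hc : notNonposInt c) (n : ℕ) : poch c n ≠ 0 := by
  induction n with
  | zero => simp [poch_zero]
  | succ n ih =>
    rw [poch_succ]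
    exact mul_ne_zero ih fun h => hc n (eq_neg_of_add_eq_zero_left h)

theorem notNonposInt.add_natCast {c : ℂ} (hc : notNonposInt c) (m : ℕ) :
    notNonposInt (c + m) := fun n h => hc (m + n) (by push_cast; linear_combination h)

/-- A sequence whose consecutive ratios tend to `1` grows slower than any `q ^ n` with `q > 1`. -/
theorem exists_norm_le_mul_pow_of_ratio_tendsto_one {u r : ℕ → ℂ}
    (hu : ∀ n, u (n + 1) = u n * r n) (hr : Tendsto r atTop (𝓝 1)) {q : ℝ} (hq : 1 < q) :
    ∃ C, 0 ≤ C ∧ ∀ n, ‖u n‖ ≤ C * q ^ n := by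
  have hq0 : 0 < q := by linarith
  obtain ⟨s, hs1, hsq⟩ := exists_between hq
  have hsum : Summable fun n => ‖u n‖ / q ^ n := by
    refine summable_of_ratio_norm_eventually_le (r := s / q) ((div_lt_one hq0).2 hsq) ?_
    have hrn : Tendsto (fun n => ‖r n‖) atTop (𝓝 1) := by simpa using hr.norm
    filter_upwards [hrn.eventually_le_const hs1] with n hn
    have hle : ‖u n‖ * ‖r n‖ ≤ ‖u n‖ * s := by gcongr
    rw [hu, norm_mul, pow_succ, Real.norm_of_nonneg (by positivity),
      Real.norm_of_nonneg (by positivity)]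
    calc ‖u n‖ * ‖r n‖ / (q ^ n * q) ≤ ‖u n‖ * s / (q ^ n * q) := by gcongr
      _ = s / q * (‖u n‖ / q ^ n) := by field_simp
  refine ⟨∑' n, ‖u n‖ / q ^ n, tsum_nonneg fun n => by positivity, fun n => ?_⟩
  have := hsum.le_tsum n fun j _ => by positivity
  rwa [div_le_iff₀ (by positivity)] at this

theorem tendsto_add_natCast_div_add_natCast (a c : ℂ) :
    Tendsto (fun n : ℕ => (a + n) / (c + n)) atTop (𝓝 1) := by
  have h (z : ℂ) : Tendsto (fun n : ℕ => z / (n : ℂ) + 1) atTop (𝓝 1) := by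
    simpa using (tendsto_const_div_atTop_nhds_zero_nat z).add_const 1
  have := (h a).div (h c) one_ne_zero
  rw [div_one] at this
  refine this.congr' ?_
  filter_upwards [eventually_ne_atTop 0] with n hn
  have hn' : (n : ℂ) ≠ 0 := by exact_mod_cast hn
  simp only [Pi.div_apply]
  rw [div_add_one hn', div_add_one hn', div_div_div_cancel_right₀ hn']

theorem exists_norm_poch_div_factorial_le (a : ℂ) {q : ℝ} (hq : 1 < q) :
    ∃ C, 0 ≤ C ∧ ∀ n, ‖poch a n / n.factorial‖ ≤ C * q ^ n := by
  refine exists_norm_le_mul_pow_of_ratio_tendsto_one (fun n => ?_)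
    (tendsto_add_natCast_div_add_natCast a 1) hq
  rw [poch_succ, Nat.factorial_succ]
  push_cast
  rw [mul_comm ((n : ℂ) + 1), mul_div_mul_comm, add_comm (n : ℂ) 1]

theorem exists_norm_factorial_div_poch_le (c : ℂ) {q : ℝ} (hq : 1 < q) :
    ∃ C, 0 ≤ C ∧ ∀ n, ‖(n.factorial : ℂ) / poch c n‖ ≤ C * q ^ n := by
  refine exists_norm_le_mul_pow_of_ratio_tendsto_one (fun n => ?_)
    (tendsto_add_natCast_div_add_natCast 1 c) hq
  rw [poch_succ, Nat.factorial_succ]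
  push_cast
  rw [mul_comm ((n : ℂ) + 1), mul_div_mul_comm, add_comm (n : ℂ) 1]

theorem exists_one_lt_pow_three_mul_lt_one {M : ℝ} (hM : M < 1) :
    ∃ q : ℝ, 1 < q ∧ q ^ 3 * M < 1 := by
  have hc : Tendsto (fun q : ℝ => q ^ 3 * M) (𝓝[>] 1) (𝓝 (1 ^ 3 * M)) :=
    ((by fun_prop : Continuous fun q : ℝ => q ^ 3 * M).tendsto 1).mono_left nhdsWithin_le_nhds
  obtain ⟨q, hq, hq1⟩ :=
    ((hc.eventually_lt_const (by simpa using hM)).and self_mem_nhdsWithin).exists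
  exact ⟨q, hq1, hq⟩

/-- The Chu–Vandermonde identity. -/
theorem sum_antidiagonal_choose_mul_poch_div (N : ℕ) (x : ℂ) {c : ℂ} (hc : notNonposInt c) :
    ∑ p ∈ antidiagonal N, (N.choose p.1 : ℂ) * ((-1) ^ p.1 * poch x p.1 / poch c p.1) =
      poch (c - x) N / poch c N := by
  induction N generalizing x c with
  | zero => simp [poch_zero]
  | succ N ih =>
    have hc1 : notNonposInt (c + 1) := by simpa using hc.add_natCast 1
    have hc0 : c ≠ 0 := by simpa using hc 0
    have hcN : c + N ≠ 0 := fun h => hc N (eq_neg_of_add_eq_zero_left h)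
    have hp := poch_ne_zero hc N
    have hp1 := poch_ne_zero hc1 N
    have hshift : poch c N * (c + N) = c * poch (c + 1) N := by
      rw [← poch_succ, poch_succ_left]
    have hsum : ∑ p ∈ antidiagonal N,
        (N.choose p.2 : ℂ) * ((-1) ^ (p.1 + 1) * poch x (p.1 + 1) / poch c (p.1 + 1)) =
        -(x / c) * (poch (c - x) N / poch (c + 1) N) := by
      have := ih (x + 1) hc1
      rw [add_sub_add_right_eq_sub] at this
      rw [← this, mul_sum]
      refine sum_congr rfl fun p hp => ?_
      have hpp := poch_ne_zero hc1 p.1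
      rw [← Nat.choose_symm_of_eq_add (mem_antidiagonal.1 hp).symm, poch_succ_left x,
        poch_succ_left c]
      field_simp
      ring
    rw [sum_antidiagonal_choose_succ_mul
      (fun i _ => (-1) ^ i * poch x i / poch c i), ih x hc, hsum, poch_succ, poch_succ, hshift]
    have : poch c N = c * poch (c + 1) N / (c + N) := by rw [← hshift]; field_simp
    rw [this]
    field_simp
    ring

/-- Newton's binomial series in terms of Pochhammer symbols. -/
theorem hasSum_poch_div_factorial_mul_pow (s : ℂ) {ω : ℂ} (hω : ‖ω‖ < 1) :
    HasSum (fun n : ℕ => poch s n / n.factorial * ω ^ n) ((1 - ω) ^ (-s)) := by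
  have h := (one_div_one_sub_cpow_hasFPowerSeriesOnBall_zero s).hasSum (y := ω)
    (by rw [← ENNReal.ofReal_one, Metric.eball_ofReal]; simpa using hω)
  rw [zero_add, one_div, ← cpow_neg] at h
  convert! h using 2 with n
  have hf := Ring.factorial_nsmul_multichoose_eq_ascPochhammer s n
  rw [Polynomial.ascPochhammer_smeval_eq_eval, Ring.multichoose_eq, nsmul_eq_mul] at hf
  have hn : (n.factorial : ℂ) ≠ 0 := by exact_mod_cast n.factorial_ne_zero
  simp [poch, ← hf, hn, mul_comm]

theorem summable_choose_mul_pow {s : ℝ} (hs0 : 0 ≤ s) (hs : 2 * s < 1) :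
    Summable fun p : ℕ × ℕ => ((p.1 + p.2).choose p.1 : ℝ) * s ^ (p.1 + p.2) := by
  rw [← HasAntidiagonal.sigmaAntidiagonalEquivProd.summable_iff,
    summable_sigma_of_nonneg fun _ => by simp only [Function.comp_apply]; positivity]
  refine ⟨fun N => Summable.of_finite, ?_⟩
  refine (summable_geometric_of_lt_one (by positivity) hs).congr fun N => ?_
  rw [tsum_fintype]
  simp only [Function.comp_apply, HasAntidiagonal.sigmaAntidiagonalEquivProd_apply]
  rw [sum_coe_sort (antidiagonal N)
    fun p : ℕ × ℕ => ((p.1 + p.2).choose p.1 : ℝ) * s ^ (p.1 + p.2)]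
  have h := sum_congr (rfl : antidiagonal N = _) (f := fun p : ℕ × ℕ =>
    ((p.1 + p.2).choose p.1 : ℝ) * s ^ (p.1 + p.2))
    (g := fun p => (N.choose p.1 : ℝ) * s ^ N) fun p hp => by rw [mem_antidiagonal.1 hp]
  rw [h, ← sum_mul, mul_pow, Nat.sum_antidiagonal_eq_sum_range_succ_mk]
  exact_mod_cast congrArg (fun t : ℕ => (t : ℝ) * s ^ N) (Nat.sum_range_choose N).symm

/-- The double series that is summed in two ways in the proof of the Pfaff transformation. -/
noncomputable def pfaffTerm (b x c ω : ℂ) (p : ℕ × ℕ) : ℂ :=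
  poch b (p.1 + p.2) / (p.1.factorial * p.2.factorial) *
    ((-1) ^ p.1 * poch x p.1 / poch c p.1) * ω ^ (p.1 + p.2)

theorem pfaffTerm_eq_choose (b x c ω : ℂ) (p : ℕ × ℕ) :
    pfaffTerm b x c ω p = poch b (p.1 + p.2) / (p.1 + p.2).factorial * ω ^ (p.1 + p.2) *
      ((p.1 + p.2).choose p.1 * ((-1) ^ p.1 * poch x p.1 / poch c p.1)) := by
  have h : ((p.1 + p.2).choose p.1 : ℂ) * p.1.factorial * p.2.factorial =
      (p.1 + p.2).factorial := by
    rw [Nat.choose_symm_add]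
    exact_mod_cast Nat.add_choose_mul_factorial_mul_factorial p.1 p.2
  have h1 : (p.1.factorial : ℂ) ≠ 0 := by exact_mod_cast p.1.factorial_ne_zero
  have h2 : (p.2.factorial : ℂ) ≠ 0 := by exact_mod_cast p.2.factorial_ne_zero
  have h3 : ((p.1 + p.2).choose p.1 : ℂ) ≠ 0 := by
    exact_mod_cast (Nat.choose_pos (Nat.le_add_right _ _)).ne'
  rw [pfaffTerm, ← h]
  field_simp

theorem summable_pfaffTerm (b x c : ℂ) {ω : ℂ} (hω : ‖ω‖ < 1 / 2) :
    Summable (pfaffTerm b x c ω) := by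
  obtain ⟨q, hq, hqω⟩ := exists_one_lt_pow_three_mul_lt_one (M := 2 * ‖ω‖) (by linarith)
  obtain ⟨B, hB0, hB⟩ := exists_norm_poch_div_factorial_le b hq
  obtain ⟨X, hX0, hX⟩ := exists_norm_poch_div_factorial_le x hq
  obtain ⟨K, hK0, hK⟩ := exists_norm_factorial_div_poch_le c hq
  have hq0 : 0 < q := by linarith
  refine Summable.of_norm_bounded ((summable_choose_mul_pow (s := q ^ 3 * ‖ω‖) (by positivity)
    (by linarith)).mul_left (B * X * K)) fun p => ?_
  have hx : ‖(-1) ^ p.1 * poch x p.1 / poch c p.1‖ ≤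
      X * q ^ (p.1 + p.2) * (K * q ^ (p.1 + p.2)) := by
    have hf : (p.1.factorial : ℂ) ≠ 0 := by exact_mod_cast p.1.factorial_ne_zero
    have : (-1) ^ p.1 * poch x p.1 / poch c p.1 =
        (-1) ^ p.1 * (poch x p.1 / p.1.factorial * (p.1.factorial / poch c p.1)) := by
      field_simp
    rw [this, norm_mul, norm_mul, norm_pow, norm_neg, norm_one, one_pow, one_mul]
    have hle : q ^ p.1 ≤ q ^ (p.1 + p.2) := pow_le_pow_right₀ hq.le (Nat.le_add_right _ _)
    exact mul_le_mul ((hX _).trans (by gcongr)) ((hK _).trans (by gcongr)) (norm_nonneg _)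
      (by positivity)
  rw [pfaffTerm_eq_choose, norm_mul, norm_mul, norm_mul, norm_pow, norm_natCast]
  calc _ ≤ B * q ^ (p.1 + p.2) * ‖ω‖ ^ (p.1 + p.2) * ((p.1 + p.2).choose p.1 *
        (X * q ^ (p.1 + p.2) * (K * q ^ (p.1 + p.2)))) := by
        gcongr
        exact hB _
    _ = _ := by ring

/-- The Pfaff transformation of the Gauss hypergeometric series. -/
theorem GaussF_eq_one_sub_cpow_mul_GaussF (b d : ℂ) {c ω : ℂ} (hc : notNonposInt c)
    (hω : ‖ω‖ < 1 / 2) :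
    GaussF b d c ω = (1 - ω) ^ (-b) * GaussF b (c - d) c (ω / (ω - 1)) := by
  have hs := summable_pfaffTerm b (c - d) c hω
  have hω1 : 1 - ω ≠ 0 := by
    intro h
    rw [← sub_eq_zero.1 h] at hω
    norm_num at hω
  have hω2 : ω - 1 ≠ 0 := by rwa [← neg_sub, neg_ne_zero]
  have hrows : ∑' p, pfaffTerm b (c - d) c ω p =
      (1 - ω) ^ (-b) * GaussF b (c - d) c (ω / (ω - 1)) := by
    rw [hs.tsum_prod, GaussF, ← tsum_mul_left]
    refine tsum_congr fun n => ?_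
    have h := (hasSum_poch_div_factorial_mul_pow (b + n) (by linarith : ‖ω‖ < 1)).mul_left
      (poch b n * poch (c - d) n / (n.factorial * poch c n) * (-1) ^ n * ω ^ n)
    have hterm : (fun j => pfaffTerm b (c - d) c ω (n, j)) = fun j =>
        poch b n * poch (c - d) n / (n.factorial * poch c n) * (-1) ^ n * ω ^ n *
          (poch (b + n) j / j.factorial * ω ^ j) := by
      funext j
      simp only [pfaffTerm, poch_add, pow_add, div_eq_mul_inv, mul_inv]
      ring
    rw [hterm, h.tsum_eq, neg_add, ← sub_eq_add_neg, cpow_sub _ _ hω1, cpow_natCast, div_pow,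
      ← neg_sub 1 ω, neg_pow (1 - ω)]
    have : ((-1 : ℂ) ^ n) * (-1) ^ n = 1 := by rw [← mul_pow]; simp
    have h1 : ((-1 : ℂ) ^ n) ≠ 0 := by simp
    have h2 := pow_ne_zero n hω1
    field_simp
    linear_combination (poch b n * poch (c - d) n * ω ^ n * (1 - ω) ^ (-b) /
      (n.factorial * poch c n)) * this
  have hdiag : ∑' p, pfaffTerm b (c - d) c ω p = GaussF b d c ω := by
    rw [← HasAntidiagonal.sigmaAntidiagonalEquivProd.tsum_eq, GaussF]
    refine ((HasAntidiagonal.sigmaAntidiagonalEquivProd.summable_iff.2 hs).tsum_sigma'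
      fun _ => Summable.of_finite).trans ?_
    refine tsum_congr fun N => ?_
    rw [tsum_fintype]
    simp only [Function.comp_apply, HasAntidiagonal.sigmaAntidiagonalEquivProd_apply]
    rw [sum_coe_sort (antidiagonal N) (pfaffTerm b (c - d) c ω)]
    have h := sum_antidiagonal_choose_mul_poch_div N (c - d) hc
    rw [sub_sub_cancel] at h
    calc _ = ∑ p ∈ antidiagonal N, poch b N / N.factorial * ω ^ N *
          ((N.choose p.1 : ℂ) * ((-1) ^ p.1 * poch (c - d) p.1 / poch c p.1)) :=
          sum_congr rfl fun p hp => by rw [pfaffTerm_eq_choose, mem_antidiagonal.1 hp]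
      _ = _ := by
        rw [← mul_sum, h, mul_comm _ (poch c N)]
        simp only [div_eq_mul_inv, mul_inv]
        ring
  rw [← hdiag, hrows]

theorem summable_Phi3_term (a b c d e : ℂ) {σ ω : ℂ} (ρ : ℂ) (hσ : ‖σ‖ < 1) (hω : ‖ω‖ < 1) :
    Summable fun t : ℕ × ℕ × ℕ => poch a t.1 * poch b t.2.1 * poch c t.1 * poch d t.2.1 /
      ((t.1.factorial : ℂ) * (t.2.1.factorial : ℂ) * (t.2.2.factorial : ℂ) *
        poch e (t.1 + t.2.1 + t.2.2)) * σ ^ t.1 * ω ^ t.2.1 * ρ ^ t.2.2 := by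
  obtain ⟨q, hq, hqM⟩ := exists_one_lt_pow_three_mul_lt_one (max_lt hσ hω)
  have hq0 : 0 < q := by linarith
  have hqσ : q ^ 3 * ‖σ‖ < 1 := lt_of_le_of_lt (by gcongr; exact le_max_left _ _) hqM
  have hqω : q ^ 3 * ‖ω‖ < 1 := lt_of_le_of_lt (by gcongr; exact le_max_right _ _) hqM
  obtain ⟨A, hA0, hA⟩ := exists_norm_poch_div_factorial_le a hq
  obtain ⟨B, hB0, hB⟩ := exists_norm_poch_div_factorial_le b hq
  obtain ⟨C, hC0, hC⟩ := exists_norm_poch_div_factorial_le c hq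
  obtain ⟨D, hD0, hD⟩ := exists_norm_poch_div_factorial_le d hq
  obtain ⟨E, hE0, hE⟩ := exists_norm_factorial_div_poch_le e hq
  have hdom : Summable fun t : ℕ × ℕ × ℕ =>
      (q ^ 3 * ‖σ‖) ^ t.1 * ((q ^ 3 * ‖ω‖) ^ t.2.1 * ((q * ‖ρ‖) ^ t.2.2 / t.2.2.factorial)) :=
    (summable_geometric_of_lt_one (by positivity) hqσ).mul_of_nonneg
      ((summable_geometric_of_lt_one (by positivity) hqω).mul_of_nonneg
        (Real.summable_pow_div_factorial (q * ‖ρ‖)) (fun _ => by positivity)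
        fun _ => by positivity) (fun _ => by positivity) fun _ => by positivity
  refine Summable.of_norm_bounded (hdom.mul_left (A * B * C * D * E)) ?_
  rintro ⟨m, n, k⟩
  have hm : (m.factorial : ℂ) ≠ 0 := by exact_mod_cast m.factorial_ne_zero
  have hn : (n.factorial : ℂ) ≠ 0 := by exact_mod_cast n.factorial_ne_zero
  have hk : (k.factorial : ℂ) ≠ 0 := by exact_mod_cast k.factorial_ne_zero
  have hN : ((m + n + k).factorial : ℂ) ≠ 0 := by exact_mod_cast (m + n + k).factorial_ne_zero
  have hfac : (m.factorial * n.factorial / (m + n + k).factorial : ℝ) ≤ 1 := by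
    rw [div_le_one (by positivity)]
    exact_mod_cast (Nat.le_of_dvd (Nat.factorial_pos _)
      (Nat.factorial_mul_factorial_dvd_factorial_add m n)).trans
        (Nat.factorial_le (Nat.le_add_right _ _))
  have hsplit : poch a m * poch b n * poch c m * poch d n /
      ((m.factorial : ℂ) * n.factorial * k.factorial * poch e (m + n + k)) *
        σ ^ m * ω ^ n * ρ ^ k =
      (poch a m / m.factorial) * (poch b n / n.factorial) * (poch c m / m.factorial) *
        (poch d n / n.factorial) * ((m + n + k).factorial / poch e (m + n + k)) *
        (m.factorial * n.factorial / (m + n + k).factorial) *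
        (σ ^ m * ω ^ n * (ρ ^ k / k.factorial)) := by
    field_simp
  rw [hsplit]
  simp only [norm_mul]
  have hnorm : ‖(m.factorial * n.factorial / (m + n + k).factorial : ℂ)‖ ≤ 1 := by
    simpa using hfac
  calc _ ≤ (A * q ^ m) * (B * q ^ n) * (C * q ^ m) * (D * q ^ n) * (E * q ^ (m + n + k)) * 1 *
        (‖σ ^ m‖ * ‖ω ^ n‖ * ‖ρ ^ k / k.factorial‖) := by
        gcongr
        exacts [hA _, hB _, hC _, hD _, hE _]
    _ = _ := by
        simp only [norm_pow, norm_div, norm_natCast]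
        ring

/-- Analytic continuation formula (21): `Φ = (1−ω)^{−b} Ψ₀₀[…; σ, ω/(ω−1), ρ]`. -/
theorem Phi3_eq_Psi00 (a b c d e σ ω ρ : ℂ)
    (he : notNonposInt e) (hσ : ‖σ‖ < 1) (hω : ‖ω‖ < 1 / 2) :
    Phi3 a b c d e σ ω ρ =
      (1 - ω) ^ (-b) * PsiPQ 0 0 a b c d 1 1 e 1 1 σ (ω / (ω - 1)) ρ := by
  have hs := summable_Phi3_term a b c d e ρ hσ (by linarith : ‖ω‖ < 1)
  let φ : (ℕ × ℕ) × ℕ ≃ ℕ × ℕ × ℕ :=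
    (Equiv.prodAssoc ℕ ℕ ℕ).trans ((Equiv.refl ℕ).prodCongr (Equiv.prodComm ℕ ℕ))
  rw [Phi3, ← φ.tsum_eq, PsiPQ, ← tsum_mul_left]
  refine (φ.summable_iff.2 hs).tsum_prod.trans (tsum_congr fun ⟨m, k⟩ => ?_)
  have hc : notNonposInt (e + m + k) := (he.add_natCast m).add_natCast k
  have hpfaff := GaussF_eq_one_sub_cpow_mul_GaussF b d hc hω
  rw [show e + m + k - d = e - d + m + k by ring] at hpfaff
  have hinner : ∑' n, poch a m * poch b n * poch c m * poch d n /
      ((m.factorial : ℂ) * n.factorial * k.factorial * poch e (m + n + k)) *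
        σ ^ m * ω ^ n * ρ ^ k =
      poch a m * poch c m / (m.factorial * k.factorial * poch e (m + k)) * σ ^ m * ρ ^ k *
        GaussF b d (e + m + k) ω := by
    rw [GaussF, ← tsum_mul_left]
    refine tsum_congr fun n => ?_
    rw [add_right_comm m n k, poch_add e (m + k) n, Nat.cast_add, ← add_assoc]
    simp only [div_eq_mul_inv, mul_inv]
    ring
  refine hinner.trans ?_
  rw [hpfaff]
  simp only [zero_mul, poch_zero, mul_one]
  ring
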